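/- Low-Rank Plus Diagonal approximation: Let A ∈ ℝ^{n×n} and let W = 1 − I be the binary matrix which is 0 on the diagonal and 1 off the diagonal. Fix ε ∈ (0,1] and a rank parameter k ≥ 1, and let k' ≥ 32k/ε. Then every matrix L of rank at most k' satisfying ‖A ∘ W − L‖_F² ≤ (min over matrices L̂ of rank at most k' of ‖A ∘ W − L̂‖_F²) + ε·‖A ∘ W‖_F² also satisfies ‖(A − L) ∘ W‖_F² ≤ OPT + 2ε·‖A ∘ W‖_F², where OPT = min over matrices L̂ of rank at most k of ‖(A − L̂) ∘ W‖_F². -/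

import Mathlib

open Matrix BigOperators

/-- Squared Frobenius norm. -/
noncomputable def frob2 {n p : ℕ} (M : Matrix (Fin n) (Fin p) ℝ) : ℝ :=
  ∑ i, ∑ j, (M i j) ^ 2

/-- Weighted max-cut by averaging: some `t`-colouring makes at most a `1 / t` fraction of the
weight monochromatic. -/
theorem exists_coloring_monochromatic_sum_le {ι : Type*} [DecidableEq ι] {t : ℕ} [NeZero t]
    (w : ι → ι → ℝ) (hw : ∀ i, w i i = 0) (s : Finset ι) :
    ∃ h : ι → Fin t, (t : ℝ) * ∑ i ∈ s, ∑ j ∈ s, (if h i = h j then w i j else 0) ≤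
      ∑ i ∈ s, ∑ j ∈ s, w i j := by
  induction s using Finset.induction_on with
  | empty => exact ⟨fun _ => 0, by simp⟩
  | insert a s ha ih =>
    obtain ⟨h, hh⟩ := ih
    obtain ⟨c, -, hc⟩ : ∃ c ∈ (Finset.univ : Finset (Fin t)),
        (t : ℝ) * ∑ j ∈ s, (if c = h j then w a j + w j a else 0) ≤
          ∑ j ∈ s, (w a j + w j a) := by
      apply Finset.exists_le_of_sum_le Finset.univ_nonempty
      rw [← Finset.mul_sum, Finset.sum_comm]
      simp
    refine ⟨Function.update h a c, ?_⟩
    have hne : ∀ i ∈ s, Function.update h a c i = h i := fun i hi =>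
      Function.update_of_ne (ne_of_mem_of_not_mem hi ha) _ _
    have hrow : ∑ j ∈ s, (if Function.update h a c a = Function.update h a c j
        then w a j else 0) = ∑ j ∈ s, (if c = h j then w a j else 0) :=
      Finset.sum_congr rfl fun j hj => by rw [hne j hj, Function.update_self]
    have hcol : ∑ j ∈ s, (if Function.update h a c j = Function.update h a c a
        then w j a else 0) = ∑ j ∈ s, (if c = h j then w j a else 0) :=
      Finset.sum_congr rfl fun j hj => by
        rw [hne j hj, Function.update_self]; simp only [eq_comm]
    have hold : ∑ i ∈ s, ∑ j ∈ s, (if Function.update h a c i = Function.update h a c j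
        then w i j else 0) = ∑ i ∈ s, ∑ j ∈ s, (if h i = h j then w i j else 0) :=
      Finset.sum_congr rfl fun i hi => Finset.sum_congr rfl fun j hj => by
        rw [hne i hi, hne j hj]
    have hsplit : ∑ j ∈ s, (if c = h j then w a j + w j a else 0) =
        ∑ j ∈ s, (if c = h j then w a j else 0) + ∑ j ∈ s, (if c = h j then w j a else 0) := by
      rw [← Finset.sum_add_distrib]
      exact Finset.sum_congr rfl fun j _ => by split_ifs <;> simp
    simp only [Finset.sum_insert ha, Finset.sum_add_distrib, hw, ite_self, zero_add]
    rw [hrow, hcol, hold]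
    rw [hsplit, Finset.sum_add_distrib] at hc
    linarith

/-- The rank of matrices is subadditive. -/
theorem Matrix.rank_add_le_rank_add_rank {m n K : Type*} [Fintype n] [Finite m] [Field K]
    (A B : Matrix m n K) : (A + B).rank ≤ A.rank + B.rank := by
  unfold Matrix.rank
  refine (Submodule.finrank_mono ?_).trans
    (Submodule.finrank_add_le_finrank_add_finrank A.mulVecLin.range B.mulVecLin.range)
  rintro _ ⟨x, rfl⟩
  rw [Matrix.mulVecLin_add]
  exact Submodule.add_mem_sup (LinearMap.mem_range_self _ x) (LinearMap.mem_range_self _ x)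

/-- The rank of a finite sum of matrices is at most the sum of the ranks. -/
theorem Matrix.rank_sum_le {ι m n K : Type*} [Fintype n] [Finite m] [Field K]
    (s : Finset ι) (f : ι → Matrix m n K) : (∑ c ∈ s, f c).rank ≤ ∑ c ∈ s, (f c).rank := by
  classical
  induction s using Finset.induction_on with
  | empty => simp
  | insert a s ha ih =>
    rw [Finset.sum_insert ha, Finset.sum_insert ha]
    exact (Matrix.rank_add_le_rank_add_rank _ _).trans (by gcongr)

/-- Erasing the monochromatic entries of a matrix under a `t`-colouring of its indices multiplies
the rank by at most `t`. -/
theorem Matrix.rank_erase_monochromatic_le {m K : Type*} [Fintype m] [DecidableEq m] [Field K]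
    {t : ℕ} (h : m → Fin t) (M : Matrix m m K) :
    (Matrix.of fun i j => if h i = h j then 0 else M i j).rank ≤ t * M.rank := by
  have hsum : (Matrix.of fun i j => if h i = h j then 0 else M i j) =
      ∑ c : Fin t, Matrix.diagonal (fun i => if h i = c then (1 : K) else 0) * M *
        Matrix.diagonal (fun j => if h j = c then (0 : K) else 1) := by
    ext i j
    simp only [Matrix.of_apply, Matrix.sum_apply, Matrix.diagonal_mul, Matrix.mul_diagonal]
    rw [Finset.sum_eq_single (h i) (fun c _ hc => by simp [hc.symm]) (by simp)]
    simp [eq_comm]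
  rw [hsum]
  refine (Matrix.rank_sum_le _ _).trans ?_
  calc _ ≤ ∑ _c : Fin t, M.rank := Finset.sum_le_sum fun c _ =>
        (Matrix.rank_mul_le_left _ _).trans (Matrix.rank_mul_le_right _ _)
    _ = t * M.rank := by simp

theorem frob2_nonneg {n p : ℕ} (M : Matrix (Fin n) (Fin p) ℝ) : 0 ≤ frob2 M :=
  Finset.sum_nonneg fun _ _ => Finset.sum_nonneg fun _ _ => sq_nonneg _

/-- Off-diagonal approximation by a matrix `M` can be turned into approximation of the whole
zero-diagonal matrix, at the cost of a factor `t` in the rank and a `1 / t` fraction of the norm. -/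
theorem exists_rank_le_frob2_sub_le {n t : ℕ} [NeZero t] (A W M : Matrix (Fin n) (Fin n) ℝ)
    (hW : ∀ i j, W i j = if i = j then 0 else 1) :
    ∃ M' : Matrix (Fin n) (Fin n) ℝ, M'.rank ≤ t * M.rank ∧
      frob2 (Matrix.hadamard A W - M') ≤
        frob2 (Matrix.hadamard (A - M) W) + frob2 (Matrix.hadamard A W) / t := by
  obtain ⟨h, hh⟩ := exists_coloring_monochromatic_sum_le (t := t)
    (fun i j => (Matrix.hadamard A W i j) ^ 2) (fun i => by simp [hW]) Finset.univ
  refine ⟨_, Matrix.rank_erase_monochromatic_le h M, ?_⟩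
  have ht : (0 : ℝ) < t := by exact_mod_cast Nat.pos_of_ne_zero (NeZero.ne t)
  have hmono : ∑ i, ∑ j, (if h i = h j then (Matrix.hadamard A W i j) ^ 2 else 0) ≤
      frob2 (Matrix.hadamard A W) / t := by
    rw [le_div_iff₀' ht]
    exact hh
  refine le_trans ?_ (add_le_add_right hmono _)
  simp only [frob2, ← Finset.sum_add_distrib]
  refine Finset.sum_le_sum fun i _ => Finset.sum_le_sum fun j _ => ?_
  by_cases hij : i = j
  · simp [hW, hij]
  · by_cases hc : h i = h j
    · simp [hW, hij, hc, sq_nonneg]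
    · simp [hW, hij, hc]

/-- Low-Rank Plus Diagonal approximation. -/
theorem stmt2
    {n k k' : ℕ} (hk : 1 ≤ k)
    (A : Matrix (Fin n) (Fin n) ℝ)
    (W : Matrix (Fin n) (Fin n) ℝ)
    (hW : ∀ i j, W i j = if i = j then 0 else 1)
    (ε : ℝ) (hε : 0 < ε) (hε1 : ε ≤ 1)
    (hk' : 32 * (k : ℝ) / ε ≤ (k' : ℝ))
    (L : Matrix (Fin n) (Fin n) ℝ) (hL_rank : L.rank ≤ k')
    (hL_near : frob2 (Matrix.hadamard A W - L) ≤
      sInf {x : ℝ | ∃ M : Matrix (Fin n) (Fin n) ℝ, M.rank ≤ k' ∧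
        x = frob2 (Matrix.hadamard A W - M)} + ε * frob2 (Matrix.hadamard A W)) :
    frob2 (Matrix.hadamard (A - L) W) ≤
      sInf {x : ℝ | ∃ M : Matrix (Fin n) (Fin n) ℝ, M.rank ≤ k ∧
        x = frob2 (Matrix.hadamard (A - M) W)} + 2 * ε * frob2 (Matrix.hadamard A W) := by
  have hdrop : frob2 (Matrix.hadamard (A - L) W) ≤ frob2 (Matrix.hadamard A W - L) := by
    refine Finset.sum_le_sum fun i _ => Finset.sum_le_sum fun j _ => ?_
    by_cases hij : i = j <;> simp [hW, hij, sq_nonneg]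
  suffices hopt : frob2 (Matrix.hadamard (A - L) W) - 2 * ε * frob2 (Matrix.hadamard A W) ≤
      sInf {x : ℝ | ∃ M : Matrix (Fin n) (Fin n) ℝ, M.rank ≤ k ∧
        x = frob2 (Matrix.hadamard (A - M) W)} by linarith
  refine le_csInf ⟨_, 0, by simp, rfl⟩ ?_
  rintro _ ⟨M, hM, rfl⟩
  set t := ⌈1 / ε⌉₊ with ht_def
  have hεinv : 1 ≤ 1 / ε := (one_le_div hε).2 hε1
  have ht_pos : 0 < t := Nat.ceil_pos.2 (by positivity)
  have ht_le : (t : ℝ) ≤ 32 / ε := by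
    have hlt := Nat.ceil_lt_add_one (show 0 ≤ 1 / ε by positivity)
    have heq : 32 / ε = 32 * (1 / ε) := by ring
    rw [heq]
    linarith
  have htk : t * k ≤ k' := by
    have hmul : (t : ℝ) * k ≤ k' :=
      (mul_le_mul_of_nonneg_right ht_le k.cast_nonneg).trans (by rwa [div_mul_eq_mul_div])
    exact_mod_cast hmul
  have : NeZero t := ⟨ht_pos.ne'⟩
  obtain ⟨M', hM'_rank, hM'⟩ := exists_rank_le_frob2_sub_le (t := t) A W M hW
  have hinf : sInf {x : ℝ | ∃ M : Matrix (Fin n) (Fin n) ℝ, M.rank ≤ k' ∧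
      x = frob2 (Matrix.hadamard A W - M)} ≤ frob2 (Matrix.hadamard A W - M') := by
    refine csInf_le ⟨0, ?_⟩ ⟨M', (hM'_rank.trans (Nat.mul_le_mul_left t hM)).trans htk, rfl⟩
    rintro _ ⟨N, -, rfl⟩
    exact frob2_nonneg _
  have hfrac : frob2 (Matrix.hadamard A W) / t ≤ ε * frob2 (Matrix.hadamard A W) := by
    rw [div_eq_inv_mul]
    refine mul_le_mul_of_nonneg_right ?_ (frob2_nonneg _)
    exact inv_le_of_inv_le₀ hε (by simpa [ht_def] using Nat.le_ceil (1 / ε))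
  linarith
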